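/- Let λ, μ be partitions with μ ⊆ λ, let k be the number of parts of λ, and let ν be a partition with l parts. Then Σ_π χ_π = Σ_α L_{να} f_{αμ}^λ, where the left-hand sum runs over all reverse plane partitions π of shape λ/μ with entries in {1,…,l} and weight θ(π) = ν, and the right-hand sum runs over all partitions α. -/

import Mathlib

open Finset

/-- The distinct rearrangements of a `k`-tuple of naturals. -/
def rearr {k : ℕ} (a : Fin k → ℕ) : Finset (Fin k → ℕ) :=
  Finset.univ.image (fun w : Equiv.Perm (Fin k) => a ∘ w)

/-- `conjP a j` is the `j`-th part of the conjugate partition of the tuple `a`. -/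
def conjP {k : ℕ} (a : Fin k → ℕ) (j : ℕ) : ℕ :=
  (Finset.univ.filter fun i => j ≤ a i).card

/-- The weight factor `χ_{λ/μ} = Π_{i≥1} binom(λ'_i − μ'_{i+1}, μ'_i − μ'_{i+1})` if
`μ ⊆ λ`, and `0` otherwise.  (All factors with `j > λ_1 = sup λ` equal `1`.) -/
def chiSkew {k : ℕ} (lam mu : Fin k → ℕ) : ℕ :=
  if ∀ i, mu i ≤ lam i then
    ∏ j ∈ Finset.Icc 1 (Finset.univ.sup lam),
      Nat.choose (conjP lam j - conjP mu (j + 1)) (conjP mu j - conjP mu (j + 1))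
  else 0

/-- `f_{αμ}^λ`: the number of pairs `(a,b)` with `a` a distinct rearrangement of `α`,
`b` a distinct rearrangement of `μ` and `a + b = λ`. -/
def fCoeff {k : ℕ} (al mu lam : Fin k → ℕ) : ℕ :=
  (((rearr al) ×ˢ (rearr mu)).filter fun p => p.1 + p.2 = lam).card

/-- `L_{να}`: the number of matrices with nonnegative integer entries, only finitely
many of them nonzero, with row-sum sequence `rowS` and column-sum sequence `colS`. -/
noncomputable def LCard (rowS colS : ℕ → ℕ) : ℕ :=
  Nat.card {A : ℕ → ℕ → ℕ //
    {p : ℕ × ℕ | A p.1 p.2 ≠ 0}.Finite ∧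
    (∀ i, ∑ᶠ j, A i j = rowS i) ∧ (∀ j, ∑ᶠ i, A i j = colS j)}

/-- Zero-padding of a tuple to a sequence `ℕ → ℕ`. -/
def pad {k : ℕ} (a : Fin k → ℕ) : ℕ → ℕ :=
  fun j => if h : j < k then a ⟨j, h⟩ else 0


section helpers
open scoped Classical
variable {k : ℕ}

lemma mem_rearr {a c : Fin k → ℕ} : c ∈ rearr a ↔ ∃ w : Equiv.Perm (Fin k), a ∘ w = c := by
  simp [rearr]

lemma conjP_comp (a : Fin k → ℕ) (w : Equiv.Perm (Fin k)) (j : ℕ) :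
    conjP (a ∘ w) j = conjP a j := by
  unfold conjP
  apply Finset.card_bij (fun i _ => w i)
  · intro i hi; simpa using hi
  · intro i _ j _ h; exact w.injective h
  · intro i hi; exact ⟨w.symm i, by simpa using hi, by simp⟩

lemma fiber_card (a : Fin k → ℕ) (v : ℕ) :
    Fintype.card {i // a i = v} + conjP a (v + 1) = conjP a v := by
  unfold conjP
  rw [Fintype.card_subtype, ← Finset.card_union_of_disjoint]
  · congr 1; ext i; simp; omega
  · rw [Finset.disjoint_left]; intro i; simp; omega

lemma mem_rearr_iff {a c : Fin k → ℕ} : c ∈ rearr a ↔ ∀ j, 1 ≤ j → conjP c j = conjP a j := by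
  constructor
  · intro h j _
    obtain ⟨w, rfl⟩ := mem_rearr.1 h
    exact conjP_comp a w j
  · intro h
    have h' : ∀ j, conjP c j = conjP a j := by
      intro j
      rcases Nat.eq_zero_or_pos j with rfl | hj
      · simp [conjP]
      · exact h j hj
    have he : ∀ v, Nonempty ({i // c i = v} ≃ {i // a i = v}) := by
      intro v
      apply Fintype.card_eq.1
      have h1 := fiber_card c v
      have h2 := fiber_card a v
      rw [h', h'] at h1
      omega
    have e := fun v => Classical.choice (he v)
    let E := ((Equiv.sigmaFiberEquiv c).symm.trans
      (Equiv.sigmaCongrRight fun v => e v)).trans (Equiv.sigmaFiberEquiv a)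
    refine mem_rearr.2 ⟨E, ?_⟩
    ext i
    simp only [E, Function.comp, Equiv.trans_apply, Equiv.sigmaFiberEquiv,
      Equiv.sigmaCongrRight_apply]
    exact ((e (c i)) ⟨i, rfl⟩).2

lemma rearr_sum {a c : Fin k → ℕ} (h : c ∈ rearr a) : ∑ i, c i = ∑ i, a i := by
  obtain ⟨w, rfl⟩ := mem_rearr.1 h
  exact Equiv.sum_comp w a

lemma rearr_symm {a c : Fin k → ℕ} (h : c ∈ rearr a) : a ∈ rearr c := by
  rw [mem_rearr_iff] at *
  intro j hj; rw [h j hj]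

lemma anti_le {ka la c : Fin k → ℕ} (hk : Antitone ka) (hl : Antitone la)
    (hc : c ∈ rearr ka) (hle : c ≤ la) : ka ≤ la := by
  intro i
  by_contra hlt
  replace hlt : la i < ka i := not_le.1 hlt
  have h1 : conjP la (ka i) ≤ i := by
    have : (Finset.univ.filter fun t => ka i ≤ la t) ⊆ Finset.Iio i := by
      intro t ht
      simp only [Finset.mem_filter, Finset.mem_univ, true_and] at ht
      rw [Finset.mem_Iio]
      by_contra h
      have h5 : la t ≤ la i := hl (not_lt.1 h)
      omega
    simpa [conjP] using Finset.card_le_card this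
  have h2 : (i : ℕ) + 1 ≤ conjP ka (ka i) := by
    have : Finset.Iic i ⊆ (Finset.univ.filter fun t => ka i ≤ ka t) := by
      intro t ht
      simpa using hk (Finset.mem_Iic.1 ht)
    simpa [conjP] using Finset.card_le_card this
  have h3 : conjP c (ka i) ≤ conjP la (ka i) := by
    apply Finset.card_le_card
    intro t
    simp only [Finset.mem_filter, Finset.mem_univ, true_and]
    intro h; exact h.trans (hle t)
  have h4 := mem_rearr_iff.1 hc (ka i) (by omega)
  omega

lemma anti_unique {ka la c : Fin k → ℕ} (hk : Antitone ka) (hl : Antitone la)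
    (h1 : c ∈ rearr ka) (h2 : c ∈ rearr la) : ka = la := by
  have h : la ∈ rearr ka := by
    rw [mem_rearr_iff] at *
    intro j hj; rw [← h1 j hj, h2 j hj]
  exact le_antisymm (anti_le hk hl h le_rfl) (anti_le hl hk (rearr_symm h) le_rfl)

lemma exists_sort (c : Fin k → ℕ) : ∃ a : Fin k → ℕ, Antitone a ∧ c ∈ rearr a := by
  refine ⟨c ∘ Tuple.sort (OrderDual.toDual ∘ c), ?_, ?_⟩
  · have := Tuple.monotone_sort (OrderDual.toDual ∘ c)
    intro i j hij
    exact this hij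
  · exact rearr_symm (mem_rearr.2 ⟨_, rfl⟩)

noncomputable def sortd (c : Fin k → ℕ) : Fin k → ℕ := (exists_sort c).choose
lemma sortd_anti (c : Fin k → ℕ) : Antitone (sortd c) := (exists_sort c).choose_spec.1
lemma sortd_mem (c : Fin k → ℕ) : c ∈ rearr (sortd c) := (exists_sort c).choose_spec.2
lemma sortd_eq_iff {c a : Fin k → ℕ} (ha : Antitone a) : sortd c = a ↔ c ∈ rearr a :=
  ⟨fun h => h ▸ sortd_mem c, fun h => anti_unique (sortd_anti c) ha (sortd_mem c) h⟩

lemma conjP_pred (a : Fin k → ℕ) (j : ℕ) (hj : 1 ≤ j) :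
    conjP (fun i => a i - 1) j = conjP a (j + 1) := by
  unfold conjP; congr 1; ext i; simp; omega

lemma rearr_pred {a c : Fin k → ℕ} : c ∈ rearr a ↔
    (fun i => c i - 1) ∈ rearr (fun i => a i - 1) ∧ conjP c 1 = conjP a 1 := by
  simp only [mem_rearr_iff]
  constructor
  · intro h
    refine ⟨fun j hj => ?_, h 1 le_rfl⟩
    rw [conjP_pred _ _ hj, conjP_pred _ _ hj, h _ (by omega)]
  · rintro ⟨h, h1⟩ j hj
    obtain rfl | hj' : j = 1 ∨ 2 ≤ j := by omega
    · exact h1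
    · have := h (j - 1) (by omega)
      rw [conjP_pred _ _ (by omega), conjP_pred _ _ (by omega)] at this
      rwa [show j - 1 + 1 = j by omega] at this

lemma card_between (T U : Finset (Fin k)) (n : ℕ) (hTU : T ⊆ U) (hn : T.card ≤ n) :
    (Finset.univ.filter fun S : Finset (Fin k) => T ⊆ S ∧ S ⊆ U ∧ S.card = n).card =
      Nat.choose (U.card - T.card) (n - T.card) := by
  rw [← Finset.card_sdiff_of_subset hTU, ← Finset.card_powersetCard]
  symm
  apply Finset.card_bij' (fun S _ => S ∪ T) (fun S _ => S \ T)
  · intro S hS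
    rw [Finset.mem_powersetCard, Finset.subset_sdiff] at hS
    obtain ⟨⟨h1, h2⟩, h3⟩ := hS
    simp only [Finset.mem_filter, Finset.mem_univ, true_and]
    refine ⟨Finset.subset_union_right, Finset.union_subset h1 hTU, ?_⟩
    rw [Finset.card_union_of_disjoint h2]; omega
  · intro S hS
    simp only [Finset.mem_filter, Finset.mem_univ, true_and] at hS
    obtain ⟨h1, h2, h3⟩ := hS
    rw [Finset.mem_powersetCard]
    refine ⟨Finset.sdiff_subset_sdiff h2 le_rfl, ?_⟩
    rw [Finset.card_sdiff_of_subset h1, h3]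
  · intro S hS
    rw [Finset.mem_powersetCard, Finset.subset_sdiff] at hS
    rw [Finset.union_sdiff_right, Finset.sdiff_eq_self_of_disjoint hS.1.2]
  · intro S hS
    simp only [Finset.mem_filter, Finset.mem_univ, true_and] at hS
    exact Finset.sdiff_union_of_subset hS.1

lemma count_aux (B : ℕ) : ∀ (la ka : Fin k → ℕ), (∀ i, la i ≤ B) → ka ≤ la →
    ((rearr ka).filter fun c => c ≤ la).card =
    ∏ j ∈ Finset.Icc 1 B,
      Nat.choose (conjP la j - conjP ka (j + 1)) (conjP ka j - conjP ka (j + 1)) := by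
  induction B with
  | zero =>
    intro la ka hla hka
    have h1 : la = 0 := by ext i; simpa using hla i
    subst h1
    have h2 : ka = 0 := by ext i; simpa using hka i
    subst h2
    simp only [Finset.Icc_eq_empty_of_lt Nat.zero_lt_one, Finset.prod_empty]
    rw [Finset.card_eq_one]
    refine ⟨0, ?_⟩
    ext c
    simp only [Finset.mem_filter, Finset.mem_singleton]
    constructor
    · rintro ⟨_, h⟩; ext i; simpa using h i
    · rintro rfl; exact ⟨mem_rearr.2 ⟨1, rfl⟩, le_rfl⟩
  | succ B ih =>
    intro la ka hla hka
    have ih' := ih (fun i => la i - 1) (fun i => ka i - 1)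
      (fun i => by have := hla i; simp; omega) (fun i => by have h : ka i ≤ la i := hka i; simp; omega)
    have hprod : ∏ j ∈ Finset.Icc 1 (B + 1),
        Nat.choose (conjP la j - conjP ka (j + 1)) (conjP ka j - conjP ka (j + 1)) =
        Nat.choose (conjP la 1 - conjP ka 2) (conjP ka 1 - conjP ka 2) *
        ∏ j ∈ Finset.Icc 1 B,
          Nat.choose (conjP (fun i => la i - 1) j - conjP (fun i => ka i - 1) (j + 1))
            (conjP (fun i => ka i - 1) j - conjP (fun i => ka i - 1) (j + 1)) := by
      rw [← Finset.mul_prod_Ioc_eq_prod_Icc (by omega : 1 ≤ B + 1)]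
      congr 1
      symm
      apply Finset.prod_bij (fun j _ => j + 1)
      · intro j hj; simp at hj ⊢; omega
      · intro i _ j _ h; omega
      · intro j hj
        simp at hj
        exact ⟨j - 1, by simp; omega, by omega⟩
      · intro j hj
        simp at hj
        rw [conjP_pred _ _ (by omega), conjP_pred _ _ (by omega), conjP_pred _ _ (by omega)]
    rw [hprod, ← ih', mul_comm]
    have hmaps : ∀ c ∈ (rearr ka).filter (fun c => c ≤ la),
        (fun i => c i - 1) ∈ (rearr fun i => ka i - 1).filter (fun c => c ≤ fun i => la i - 1) := by
      intro c hc
      rw [Finset.mem_filter] at hc ⊢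
      refine ⟨(rearr_pred.1 hc.1).1, fun i => ?_⟩
      have h : c i ≤ la i := hc.2 i
      simp; omega
    rw [Finset.card_eq_sum_card_fiberwise hmaps]
    apply Finset.sum_const_nat
    intro d hd
    rw [Finset.mem_filter] at hd
    obtain ⟨hd1, hd2⟩ := hd
    have hT : (Finset.univ.filter fun i => 1 ≤ d i).card = conjP ka 2 := by
      have := mem_rearr_iff.1 hd1 1 le_rfl
      rw [conjP_pred _ _ le_rfl] at this
      exact this
    have hkk : conjP ka 2 ≤ conjP ka 1 := by
      apply Finset.card_le_card
      intro t; simp; omega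
    have key := card_between (Finset.univ.filter fun i => 1 ≤ d i)
      (Finset.univ.filter fun i => 1 ≤ la i) (conjP ka 1)
      (by intro i; have := hd2 i; simp at this ⊢; omega) (by rw [hT]; exact hkk)
    rw [hT] at key
    rw [show conjP la 1 = (Finset.univ.filter fun i => 1 ≤ la i).card from rfl, ← key]
    apply Finset.card_bij' (fun c _ => Finset.univ.filter fun i => 1 ≤ c i)
      (fun S _ => fun i => d i + if i ∈ S then 1 else 0)
    · intro c hc
      simp only [Finset.mem_filter] at hc
      obtain ⟨⟨h1, h2⟩, rfl⟩ := hc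
      simp only [Finset.mem_filter, Finset.mem_univ, true_and]
      refine ⟨?_, ?_, (rearr_pred.1 h1).2⟩
      · intro i; simp; omega
      · intro i; have h : c i ≤ la i := h2 i; simp; omega
    · intro S hS
      simp only [Finset.mem_filter, Finset.mem_univ, true_and] at hS
      obtain ⟨h1, h2, h3⟩ := hS
      have e1 : (fun i => (d i + if i ∈ S then 1 else 0) - 1) = d := by
        ext i
        by_cases h : i ∈ S
        · simp [h]
        · have : ¬ 1 ≤ d i := fun h' => h (h1 (by simpa using h'))
          simp [h]; omega
      have e2 : conjP (fun i => (d i + if i ∈ S then 1 else 0)) 1 = S.card := by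
        unfold conjP; congr 1; ext i
        by_cases h : i ∈ S
        · simp [h]
        · have : ¬ 1 ≤ d i := fun h' => h (h1 (by simpa using h'))
          simp [h]; omega
      simp only [Finset.mem_filter]
      refine ⟨⟨rearr_pred.2 ⟨by rw [e1]; exact hd1, by rw [e2, h3]⟩, ?_⟩, e1⟩
      intro i
      have := hd2 i
      simp only at this
      by_cases h : i ∈ S
      · have := h2 h
        simp [h] at this ⊢; omega
      · simp [h]; omega
    · intro c hc
      simp only [Finset.mem_filter] at hc
      obtain ⟨⟨h1, h2⟩, rfl⟩ := hc
      ext i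
      simp
      split_ifs <;> omega
    · intro S hS
      simp only [Finset.mem_filter, Finset.mem_univ, true_and] at hS
      obtain ⟨h1, h2, h3⟩ := hS
      ext i
      by_cases h : i ∈ S
      · simp [h]
      · have : ¬ 1 ≤ d i := fun h' => h (h1 (by simpa using h'))
        simp [h]; omega

lemma chi_eq {la ka : Fin k → ℕ} (h : ka ≤ la) :
    chiSkew la ka = ((rearr ka).filter fun c => c ≤ la).card := by
  rw [count_aux (Finset.univ.sup la) la ka (fun i => Finset.le_sup (Finset.mem_univ i)) h]
  unfold chiSkew
  exact if_pos h

noncomputable def Wc (mu : Fin k → ℕ) : (l : ℕ) → (Fin l → ℕ) → (Fin k → ℕ) → ℕ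
  | 0, _, la => if la ∈ rearr mu then 1 else 0
  | l + 1, nu, la => ∑ c ∈ (Finset.Iic la).filter
      (fun c => ∑ i, la i = ∑ i, c i + nu (Fin.last l)), Wc mu l (fun s => nu s.castSucc) c

lemma Wc_comp (mu : Fin k → ℕ) (w : Equiv.Perm (Fin k)) : ∀ (l : ℕ) (nu : Fin l → ℕ)
    (la : Fin k → ℕ), Wc mu l nu (la ∘ w) = Wc mu l nu la := by
  intro l
  induction l with
  | zero =>
    intro nu la
    have : la ∘ w ∈ rearr mu ↔ la ∈ rearr mu := by
      simp only [mem_rearr_iff, conjP_comp]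
    simp only [Wc, this]
  | succ l ih =>
    intro nu la
    simp only [Wc]
    symm
    apply Finset.sum_bij' (fun c _ => c ∘ w) (fun c _ => c ∘ w.symm)
    · intro c hc
      simp only [Finset.mem_filter, Finset.mem_Iic] at hc ⊢
      refine ⟨fun i => hc.1 (w i), ?_⟩
      have h1 := Equiv.sum_comp w la
      have h2 := Equiv.sum_comp w c
      simp only [Function.comp]
      rw [h1, h2]; exact hc.2
    · intro c hc
      simp only [Finset.mem_filter, Finset.mem_Iic] at hc ⊢
      refine ⟨fun i => by simpa using hc.1 (w.symm i), ?_⟩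
      have h1 := Equiv.sum_comp w la
      have h2 := Equiv.sum_comp w.symm c
      simp only [Function.comp] at hc ⊢
      rw [h2, ← h1]; exact hc.2
    · intro c _; ext i; simp
    · intro c _; ext i; simp
    · intro c _; rw [ih]

lemma Wc_rearr (mu : Fin k → ℕ) (l : ℕ) (nu : Fin l → ℕ) {a c : Fin k → ℕ} (h : c ∈ rearr a) :
    Wc mu l nu c = Wc mu l nu a := by
  obtain ⟨w, rfl⟩ := mem_rearr.1 h
  exact Wc_comp mu w l nu a

lemma Wc_succ (mu : Fin k → ℕ) (l : ℕ) (nu : Fin (l + 1) → ℕ) (la : Fin k → ℕ)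
    (hla : Antitone la) :
    Wc mu (l + 1) nu la = ∑ ka ∈ (Finset.Iic la).filter
      (fun c => Antitone c ∧ ∑ i, la i = ∑ i, c i + nu (Fin.last l)),
        chiSkew la ka * Wc mu l (fun s => nu s.castSucc) ka := by
  rw [Wc]
  rw [← Finset.sum_fiberwise_of_maps_to (g := sortd) (t := (Finset.Iic la).filter
      (fun c => Antitone c ∧ ∑ i, la i = ∑ i, c i + nu (Fin.last l)))]
  · apply Finset.sum_congr rfl
    intro ka hka
    simp only [Finset.mem_filter, Finset.mem_Iic] at hka
    obtain ⟨h1, h2, h3⟩ := hka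
    rw [chi_eq h1]
    have : (((Finset.Iic la).filter
      (fun c => ∑ i, la i = ∑ i, c i + nu (Fin.last l))).filter fun c => sortd c = ka) =
      (rearr ka).filter fun c => c ≤ la := by
      ext c
      simp only [Finset.mem_filter, Finset.mem_Iic, sortd_eq_iff h2]
      constructor
      · rintro ⟨⟨a, _⟩, b⟩; exact ⟨b, a⟩
      · rintro ⟨b, a⟩
        refine ⟨⟨a, ?_⟩, b⟩
        rw [rearr_sum b]; exact h3
    rw [this]
    apply Finset.sum_const_nat
    intro c hc
    exact Wc_rearr _ _ _ (Finset.mem_filter.1 hc).1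
  · intro c hc
    simp only [Finset.mem_filter, Finset.mem_Iic] at hc ⊢
    refine ⟨anti_le (sortd_anti c) hla (sortd_mem c) hc.1, sortd_anti c, ?_⟩
    rw [← rearr_sum (sortd_mem c)]; exact hc.2

def Pcond (mu : Fin k → ℕ) (l : ℕ) (nu : Fin l → ℕ) (la : Fin k → ℕ)
    (π : Fin (l + 1) → Fin k → ℕ) : Prop :=
  π 0 = mu ∧ π (Fin.last l) = la ∧
          (∀ s : Fin (l + 1), ∀ i j : Fin k, i ≤ j → π s j ≤ π s i) ∧
          (∀ s : Fin l, ∀ i, π s.castSucc i ≤ π s.succ i) ∧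
          (∀ s : Fin l, ∑ i, π s.succ i = ∑ i, π s.castSucc i + nu s)

lemma Pcond_snoc (mu : Fin k → ℕ) (l : ℕ) (nu : Fin (l + 1) → ℕ) (la ka : Fin k → ℕ)
    (π : Fin (l + 1) → Fin k → ℕ) (hla : Antitone la) (hle : ka ≤ la)
    (hs : ∑ i, la i = ∑ i, ka i + nu (Fin.last l))
    (h : Pcond mu l (fun s => nu s.castSucc) ka π) :
    Pcond mu (l + 1) nu la (Fin.snoc π la : Fin (l + 2) → Fin k → ℕ) := by
  obtain ⟨h1, h2, h3, h4, h5⟩ := h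
  refine ⟨?_, by simp, ?_, ?_, ?_⟩
  · rw [← Fin.castSucc_zero, Fin.snoc_castSucc]; exact h1
  · intro s
    refine Fin.lastCases ?_ (fun s => ?_) s
    · intro i j hij; simpa using hla hij
    · simpa using h3 s
  · intro s
    refine Fin.lastCases ?_ (fun s => ?_) s
    · intro i
      rw [Fin.succ_last, Fin.snoc_last, Fin.snoc_castSucc, h2]; exact hle i
    · rw [Fin.succ_castSucc, Fin.snoc_castSucc, Fin.snoc_castSucc]; exact h4 s
  · intro s
    refine Fin.lastCases ?_ (fun s => ?_) s
    · rw [Fin.succ_last, Fin.snoc_last, Fin.snoc_castSucc, h2]; exact hs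
    · rw [Fin.succ_castSucc, Fin.snoc_castSucc, Fin.snoc_castSucc]; exact h5 s

lemma Pcond_init (mu : Fin k → ℕ) (l : ℕ) (nu : Fin (l + 1) → ℕ) (la : Fin k → ℕ)
    (π : Fin (l + 2) → Fin k → ℕ) (h : Pcond mu (l + 1) nu la π) :
    Pcond mu l (fun s => nu s.castSucc) (π (Fin.last l).castSucc) (fun s => π s.castSucc) := by
  obtain ⟨h1, h2, h3, h4, h5⟩ := h
  refine ⟨h1, rfl, fun s => h3 _, ?_, ?_⟩
  · intro s
    have := h4 s.castSucc
    rwa [Fin.succ_castSucc] at this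
  · intro s
    have := h5 s.castSucc
    rwa [Fin.succ_castSucc] at this

lemma lhs_eq (mu : Fin k → ℕ) (hmu : Antitone mu) (B : ℕ) : ∀ (l : ℕ) (nu : Fin l → ℕ)
    (la : Fin k → ℕ), Antitone la → (∀ i, la i ≤ B) →
    ∑ π ∈ (Fintype.piFinset fun _ : Fin (l + 1) =>
          Fintype.piFinset fun _ : Fin k => Finset.range (B + 1)).filter
        (fun π => Pcond mu l nu la π),
        ∏ s : Fin l, chiSkew (π s.succ) (π s.castSucc) = Wc mu l nu la := by
  intro l
  induction l with
  | zero =>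
    intro nu la hla hB
    simp only [Finset.univ_eq_empty, Finset.prod_empty, Finset.sum_const, smul_eq_mul, mul_one, Wc]
    by_cases h : la ∈ rearr mu
    · have e : mu = la := anti_unique hmu hla h (mem_rearr.2 ⟨1, rfl⟩)
      subst e
      rw [if_pos h, Finset.card_eq_one]
      refine ⟨fun _ => mu, ?_⟩
      ext π
      simp only [Finset.mem_filter, Finset.mem_singleton]
      constructor
      · rintro ⟨_, h, _⟩
        funext s
        rw [show s = 0 from (Subsingleton.elim (α := Fin 1) s 0)]; exact h
      · rintro rfl
        refine ⟨?_, rfl, rfl, fun _ i j hij => hmu hij, fun s => s.elim0, fun s => s.elim0⟩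
        simp only [Fintype.mem_piFinset, Finset.mem_range]
        intro _ i; have := hB i; omega
    · rw [if_neg h, Finset.card_eq_zero, Finset.filter_eq_empty_iff]
      rintro π _ ⟨h1, h2, _⟩
      apply h
      have : la = mu := h2.symm.trans h1
      rw [this]
      exact mem_rearr.2 ⟨1, rfl⟩
  | succ l ih =>
    intro nu la hla hB
    rw [Wc_succ _ _ _ _ hla]
    rw [← Finset.sum_fiberwise_of_maps_to (g := fun π => π (Fin.last l).castSucc)
      (t := (Finset.Iic la).filter
      (fun c => Antitone c ∧ ∑ i, la i = ∑ i, c i + nu (Fin.last l)))]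
    · apply Finset.sum_congr rfl
      intro ka hka
      simp only [Finset.mem_filter, Finset.mem_Iic] at hka
      obtain ⟨g1, g2, g3⟩ := hka
      have hkB : ∀ i, ka i ≤ B := fun i => (g1 i).trans (hB i)
      rw [← ih (fun s => nu s.castSucc) ka g2 hkB, Finset.mul_sum]
      apply Finset.sum_bij' (fun π _ => (fun s => π s.castSucc : Fin (l + 1) → Fin k → ℕ))
        (fun π _ => (Fin.snoc π la : Fin (l + 2) → Fin k → ℕ))
      · intro π hπ
        simp only [Finset.mem_filter, Fintype.mem_piFinset, Finset.mem_range] at hπ ⊢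
        obtain ⟨⟨h1, h2⟩, rfl⟩ := hπ
        exact ⟨fun s i => h1 _ _, Pcond_init _ _ _ _ _ h2⟩
      · intro π hπ
        simp only [Finset.mem_filter, Fintype.mem_piFinset, Finset.mem_range] at hπ ⊢
        obtain ⟨h1, h2⟩ := hπ
        refine ⟨⟨?_, Pcond_snoc _ _ _ _ _ _ hla g1 g3 h2⟩, ?_⟩
        · intro s
          refine Fin.lastCases ?_ (fun s => ?_) s
          · intro i; have := hB i; simp; omega
          · simpa using h1 s
        · rw [Fin.snoc_castSucc]; exact h2.2.1
      · intro π hπ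
        simp only [Finset.mem_filter] at hπ
        funext s
        refine Fin.lastCases ?_ (fun s => ?_) s
        · rw [Fin.snoc_last]; exact hπ.1.2.2.1.symm
        · rw [Fin.snoc_castSucc]
      · intro π hπ
        funext s
        rw [Fin.snoc_castSucc]
      · intro π hπ
        simp only [Finset.mem_filter] at hπ
        obtain ⟨⟨h1, h2⟩, rfl⟩ := hπ
        rw [Fin.prod_univ_castSucc, mul_comm, Fin.succ_last, h2.2.1]
        simp only [Fin.succ_castSucc]
    · intro π hπ
      simp only [Finset.mem_filter, Finset.mem_Iic] at hπ ⊢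
      obtain ⟨_, h1, h2, h3, h4, h5⟩ := hπ
      have h4' := h4 (Fin.last l)
      have h5' := h5 (Fin.last l)
      rw [Fin.succ_last, h2] at h4' h5'
      exact ⟨h4', fun i j hij => h3 _ i j hij, h5'⟩

noncomputable def Ms (l : ℕ) (nu : Fin l → ℕ) (a : Fin k → ℕ) : Finset (Fin l → Fin k → ℕ) :=
  (Fintype.piFinset fun _ : Fin l => Finset.Iic a).filter fun A =>
    (∀ i, ∑ j, A i j = nu i) ∧ ∀ j, ∑ i, A i j = a j

lemma mem_Ms {l : ℕ} {nu : Fin l → ℕ} {a : Fin k → ℕ} {A : Fin l → Fin k → ℕ} :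
    A ∈ Ms l nu a ↔ (∀ i, ∑ j, A i j = nu i) ∧ ∀ j, ∑ i, A i j = a j := by
  unfold Ms
  rw [Finset.mem_filter, and_iff_right_iff_imp]
  rintro ⟨_, h⟩
  rw [Fintype.mem_piFinset]
  intro i
  rw [Finset.mem_Iic]
  intro j
  rw [← h j]
  exact Finset.single_le_sum (f := fun i => A i j) (fun _ _ => Nat.zero_le _) (Finset.mem_univ i)

lemma finsum_fin (n : ℕ) (f : ℕ → ℕ) (h : ∀ j, n ≤ j → f j = 0) :
    ∑ᶠ j, f j = ∑ j : Fin n, f j := by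
  rw [finsum_eq_sum_of_support_subset (s := Finset.range n), Finset.sum_range]
  intro j hj
  simp only [Finset.coe_range, Set.mem_Iio]
  by_contra h'
  exact hj (h j (not_lt.1 h'))

lemma finsum_van {f : ℕ → ℕ} (hf : f.support.Finite) (h : ∑ᶠ j, f j = 0) (j : ℕ) : f j = 0 := by
  rw [finsum_eq_sum _ hf, Finset.sum_eq_zero_iff] at h
  by_contra h'
  exact h' (h j (by simpa using h'))

lemma pad_lt {n : ℕ} (a : Fin n → ℕ) (i : Fin n) : pad a i = a i := by
  simp [pad]

lemma pad_ge {n : ℕ} (a : Fin n → ℕ) (i : ℕ) (h : n ≤ i) : pad a i = 0 := by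
  simp [pad]; omega

lemma LCard_eq (l : ℕ) (nu : Fin l → ℕ) (a : Fin k → ℕ) :
    LCard (pad nu) (pad a) = (Ms l nu a).card := by
  unfold LCard
  rw [← Fintype.card_coe, ← Nat.card_eq_fintype_card]
  have van : ∀ A : ℕ → ℕ → ℕ, {p : ℕ × ℕ | A p.1 p.2 ≠ 0}.Finite →
      (∀ i, ∑ᶠ j, A i j = pad nu i) → (∀ j, ∑ᶠ i, A i j = pad a j) →
      (∀ i j, l ≤ i → A i j = 0) ∧ (∀ i j, k ≤ j → A i j = 0) := by
    intro A hf h1 h2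
    constructor
    · intro i j hi
      refine finsum_van (f := fun j => A i j) ?_ ?_ j
      · refine (hf.image Prod.snd).subset ?_
        intro j hj
        exact ⟨(i, j), hj, rfl⟩
      · rw [h1, pad_ge _ _ hi]
    · intro i j hj
      refine finsum_van (f := fun i => A i j) ?_ ?_ i
      · refine (hf.image Prod.fst).subset ?_
        intro i hi
        exact ⟨(i, j), hi, rfl⟩
      · rw [h2, pad_ge _ _ hj]
  apply Nat.card_congr
  refine ⟨fun A => ⟨fun i j => A.1 i j, ?_⟩,
    fun A => ⟨fun i j => if h : i < l ∧ j < k then A.1 ⟨i, h.1⟩ ⟨j, h.2⟩ else 0, ?_, ?_, ?_⟩,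
    ?_, ?_⟩
  · obtain ⟨A, hf, h1, h2⟩ := A
    obtain ⟨v1, v2⟩ := van A hf h1 h2
    rw [mem_Ms]
    constructor
    · intro i
      have := h1 i
      rw [finsum_fin k _ (fun j hj => v2 i j hj), pad_lt] at this
      exact this
    · intro j
      have := h2 j
      rw [finsum_fin l _ (fun i hi => v1 i j hi), pad_lt] at this
      exact this
  · refine (Finset.finite_toSet (Finset.range l ×ˢ Finset.range k)).subset ?_
    rintro ⟨i, j⟩ h
    simp only [Set.mem_ofPred_eq, ne_eq, dite_eq_right_iff, not_forall] at h
    obtain ⟨h, _⟩ := h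
    simpa using h
  · intro i
    rw [finsum_fin k _ (fun j hj => by apply dif_neg; omega)]
    by_cases hi : i < l
    · have := (mem_Ms.1 A.2).1 ⟨i, hi⟩
      have e := pad_lt nu ⟨i, hi⟩
      simp only at e
      rw [e, ← this]
      simp [hi]
    · rw [pad_ge _ _ (by omega)]
      simp [hi]
  · intro j
    rw [finsum_fin l _ (fun i hi => by apply dif_neg; omega)]
    by_cases hj : j < k
    · have := (mem_Ms.1 A.2).2 ⟨j, hj⟩
      have e := pad_lt a ⟨j, hj⟩
      simp only at e
      rw [e, ← this]
      simp [hj]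
    · rw [pad_ge _ _ (by omega)]
      simp [hj]
  · rintro ⟨A, hf, h1, h2⟩
    obtain ⟨v1, v2⟩ := van A hf h1 h2
    apply Subtype.ext
    funext i j
    by_cases h : i < l ∧ j < k
    · simp [h]
    · simp only [h, dite_false]
      rw [not_and_or] at h
      rcases h with h | h
      · exact (v1 i j (by omega)).symm
      · exact (v2 i j (by omega)).symm
  · rintro ⟨A, hA⟩
    apply Subtype.ext
    funext i j
    simp

lemma Ms_comp (l : ℕ) (nu : Fin l → ℕ) (a : Fin k → ℕ) (w : Equiv.Perm (Fin k)) :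
    (Ms l nu (a ∘ w)).card = (Ms l nu a).card := by
  symm
  apply Finset.card_bij' (fun A _ => fun i => A i ∘ w) (fun A _ => fun i => A i ∘ w.symm)
  · intro A hA
    rw [mem_Ms] at hA ⊢
    refine ⟨fun i => ?_, fun j => hA.2 (w j)⟩
    rw [← hA.1 i]; exact Equiv.sum_comp w (A i)
  · intro A hA
    rw [mem_Ms] at hA ⊢
    refine ⟨fun i => ?_, fun j => ?_⟩
    · rw [← hA.1 i]; exact Equiv.sum_comp w.symm (A i)
    · simpa using hA.2 (w.symm j)
  · intro A _; funext i j; simp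
  · intro A _; funext i j; simp

lemma Ms_sum {l : ℕ} {nu : Fin l → ℕ} {a : Fin k → ℕ} (h : (Ms l nu a).card ≠ 0) :
    ∑ j, a j = ∑ i, nu i := by
  obtain ⟨A, hA⟩ := Finset.card_pos.1 (Nat.pos_of_ne_zero h)
  rw [mem_Ms] at hA
  rw [← Finset.sum_congr rfl (fun j _ => hA.2 j), ← Finset.sum_congr rfl (fun i _ => hA.1 i)]
  exact Finset.sum_comm

lemma Ms_zero (nu : Fin 0 → ℕ) (a : Fin k → ℕ) :
    (Ms 0 nu a).card = if a = 0 then 1 else 0 := by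
  split_ifs with h
  · subst h
    rw [Finset.card_eq_one]
    refine ⟨fun _ _ => 0, ?_⟩
    ext A
    rw [mem_Ms, Finset.mem_singleton]
    constructor
    · intro _; exact Subsingleton.elim _ _
    · intro _; exact ⟨fun i => i.elim0, fun j => by simp⟩
  · rw [Finset.card_eq_zero, Finset.eq_empty_iff_forall_notMem]
    intro A hA
    rw [mem_Ms] at hA
    apply h
    ext j
    rw [← hA.2 j]; simp

lemma Ms_succ (l : ℕ) (nu : Fin (l + 1) → ℕ) (a : Fin k → ℕ) :
    (Ms (l + 1) nu a).card = ∑ r ∈ (Finset.Iic a).filter (fun r => ∑ i, r i = nu (Fin.last l)),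
      (Ms l (fun s => nu s.castSucc) (a - r)).card := by
  rw [Finset.card_eq_sum_card_fiberwise (f := fun A => A (Fin.last l))
    (t := (Finset.Iic a).filter (fun r => ∑ i, r i = nu (Fin.last l)))]
  · apply Finset.sum_congr rfl
    intro r hr
    simp only [Finset.mem_filter, Finset.mem_Iic] at hr
    obtain ⟨hr1, hr2⟩ := hr
    apply Finset.card_bij' (fun A _ => (fun s => A s.castSucc : Fin l → Fin k → ℕ))
      (fun A _ => (Fin.snoc A r : Fin (l + 1) → Fin k → ℕ))
    · intro A hA
      rw [Finset.mem_filter, mem_Ms] at hA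
      obtain ⟨⟨h1, h2⟩, rfl⟩ := hA
      rw [mem_Ms]
      refine ⟨fun i => h1 _, fun j => ?_⟩
      have := h2 j
      rw [Fin.sum_univ_castSucc] at this
      simp only [Pi.sub_apply]
      omega
    · intro A hA
      rw [mem_Ms] at hA
      rw [Finset.mem_filter, mem_Ms]
      refine ⟨⟨?_, ?_⟩, by simp⟩
      · intro i
        refine Fin.lastCases ?_ (fun s => ?_) i
        · rw [Fin.snoc_last]; exact hr2
        · rw [Fin.snoc_castSucc]; exact hA.1 s
      · intro j
        rw [Fin.sum_univ_castSucc]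
        simp only [Fin.snoc_castSucc, Fin.snoc_last]
        rw [hA.2 j]
        have : r j ≤ a j := hr1 j
        simp only [Pi.sub_apply]
        omega
    · intro A hA
      rw [Finset.mem_filter] at hA
      obtain ⟨_, rfl⟩ := hA
      funext i
      refine Fin.lastCases ?_ (fun s => ?_) i
      · rw [Fin.snoc_last]
      · rw [Fin.snoc_castSucc]
    · intro A hA
      funext i
      rw [Fin.snoc_castSucc]
  · intro A hA
    have hA := mem_Ms.1 (Finset.mem_coe.1 hA)
    simp only [Finset.coe_filter, Finset.mem_Iic, Set.mem_ofPred_eq]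
    refine ⟨fun j => ?_, hA.1 _⟩
    rw [← hA.2 j]
    exact Finset.single_le_sum (f := fun i => A i j) (fun _ _ => Nat.zero_le _)
      (Finset.mem_univ (Fin.last l))

lemma V_eq (mu : Fin k → ℕ) : ∀ (l : ℕ) (nu : Fin l → ℕ) (la : Fin k → ℕ),
    ∑ b ∈ (rearr mu).filter (fun b => b ≤ la), (Ms l nu (la - b)).card = Wc mu l nu la := by
  intro l
  induction l with
  | zero =>
    intro nu la
    simp only [Ms_zero, Wc]
    rw [← Finset.sum_ite_eq' (rearr mu) la (fun _ => 1), Finset.sum_filter]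
    apply Finset.sum_congr rfl
    intro b _
    by_cases h : b = la
    · subst h; simp
    · rw [if_neg h]
      by_cases hb : b ≤ la
      · rw [if_pos hb, if_neg]
        intro h0
        apply h
        refine le_antisymm hb (fun i => ?_)
        have := congrFun h0 i
        simp only [Pi.sub_apply, Pi.zero_apply] at this
        exact Nat.sub_eq_zero_iff_le.1 this
      · rw [if_neg hb]
  | succ l ih =>
    intro nu la
    simp only [Ms_succ, Wc, ← ih]
    rw [Finset.sum_sigma', Finset.sum_sigma']
    have sub_sum : ∀ x : Fin k → ℕ, x ≤ la → ∑ i, (la - x) i + ∑ i, x i = ∑ i, la i := by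
      intro x hx
      rw [← Finset.sum_add_distrib]
      apply Finset.sum_congr rfl
      intro i _
      exact Nat.sub_add_cancel (hx i)
    refine Finset.sum_bij' (fun p _ => ⟨la - p.2, p.1⟩) (fun p _ => ⟨p.2, la - p.1⟩) ?_ ?_ ?_ ?_ ?_
    · rintro ⟨b, r⟩ h
      simp only [Finset.mem_sigma, Finset.mem_filter, Finset.mem_Iic] at h ⊢
      obtain ⟨⟨h1, h2⟩, h3, h4⟩ := h
      have hr : r ≤ la := h3.trans (fun i => Nat.sub_le _ _)
      refine ⟨⟨fun i => Nat.sub_le _ _, ?_⟩, h1, fun i => ?_⟩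
      · rw [← h4]; exact (sub_sum r hr).symm
      · have a1 : b i ≤ la i := h2 i
        have a2 : r i ≤ la i - b i := h3 i
        show b i ≤ la i - r i
        omega
    · rintro ⟨c, b⟩ h
      simp only [Finset.mem_sigma, Finset.mem_filter, Finset.mem_Iic] at h ⊢
      obtain ⟨⟨h1, h2⟩, h3, h4⟩ := h
      refine ⟨⟨h3, h4.trans h1⟩, fun i => ?_, ?_⟩
      · have a1 : b i ≤ c i := h4 i
        show la i - c i ≤ la i - b i
        omega
      · have := sub_sum c h1
        omega
    · rintro ⟨b, r⟩ h
      simp only [Finset.mem_sigma, Finset.mem_filter, Finset.mem_Iic] at h ⊢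
      obtain ⟨⟨h1, h2⟩, h3, h4⟩ := h
      congr 1
      funext i
      have a2 : r i ≤ la i - b i := h3 i
      show la i - (la i - r i) = r i
      omega
    · rintro ⟨c, b⟩ h
      simp only [Finset.mem_sigma, Finset.mem_filter, Finset.mem_Iic] at h ⊢
      obtain ⟨⟨h1, h2⟩, h3, h4⟩ := h
      congr 1
      funext i
      have a2 : c i ≤ la i := h1 i
      show la i - (la i - c i) = c i
      omega
    · rintro ⟨b, r⟩ h
      simp only
      congr 2
      funext i
      show la i - b i - r i = la i - r i - b i
      omega

lemma fCoeff_eq {al mu la : Fin k → ℕ} (hal : Antitone al) :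
    fCoeff al mu la =
      (((rearr mu).filter (fun b => b ≤ la)).filter fun b => sortd (la - b) = al).card := by
  unfold fCoeff
  apply Finset.card_bij' (fun p _ => p.2) (fun b _ => (la - b, b))
  · rintro ⟨a, b⟩ h
    simp only [Finset.mem_filter, Finset.mem_product] at h ⊢
    obtain ⟨⟨h1, h2⟩, rfl⟩ := h
    refine ⟨⟨h2, fun i => Nat.le_add_left _ _⟩, ?_⟩
    rw [sortd_eq_iff hal, add_tsub_cancel_right]; exact h1
  · intro b h
    simp only [Finset.mem_filter, Finset.mem_product, sortd_eq_iff hal] at h ⊢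
    obtain ⟨⟨h1, h2⟩, h3⟩ := h
    exact ⟨⟨h3, h1⟩, funext fun i => Nat.sub_add_cancel (h2 i)⟩
  · rintro ⟨a, b⟩ h
    simp only [Finset.mem_filter, Finset.mem_product] at h ⊢
    obtain ⟨⟨h1, h2⟩, rfl⟩ := h
    rw [add_tsub_cancel_right]
  · intro b _; rfl

lemma rhs_eq (l : ℕ) (nu : Fin l → ℕ) (la mu : Fin k → ℕ) :
    ∑ al ∈ (Fintype.piFinset fun _ : Fin k => Finset.range (∑ s, nu s + 1)).filter
          (fun al => ∀ i j : Fin k, i ≤ j → al j ≤ al i),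
        LCard (pad nu) (pad al) * fCoeff al mu la = Wc mu l nu la := by
  rw [← V_eq]
  have step : ∀ al ∈ (Fintype.piFinset fun _ : Fin k => Finset.range (∑ s, nu s + 1)).filter
          (fun al => ∀ i j : Fin k, i ≤ j → al j ≤ al i),
      LCard (pad nu) (pad al) * fCoeff al mu la =
      ∑ b ∈ ((rearr mu).filter (fun b => b ≤ la)).filter (fun b => sortd (la - b) = al),
        (Ms l nu (la - b)).card := by
    intro al hal
    have hal' : Antitone al := fun i j h => (Finset.mem_filter.1 hal).2 i j h
    rw [LCard_eq, fCoeff_eq hal', mul_comm]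
    symm
    apply Finset.sum_const_nat
    intro b hb
    have := (sortd_eq_iff hal').1 (Finset.mem_filter.1 hb).2
    obtain ⟨w, hw⟩ := mem_rearr.1 this
    rw [← hw, Ms_comp]
  rw [Finset.sum_congr rfl step, Finset.sum_fiberwise_eq_sum_filter]
  apply Finset.sum_filter_of_ne
  intro b _ hne
  have h1 := Ms_sum hne
  rw [rearr_sum (sortd_mem (la - b))] at h1
  rw [Finset.mem_filter, Fintype.mem_piFinset]
  refine ⟨fun i => ?_, fun i j h => sortd_anti _ h⟩
  rw [Finset.mem_range, ← h1, Nat.lt_succ_iff]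
  exact Finset.single_le_sum (f := fun i => sortd (la - b) i) (fun _ _ => Nat.zero_le _)
    (Finset.mem_univ i)

end helpers

/-- for partitions `μ ⊆ λ`, `λ` with `k` parts, and a partition `ν` with
`l` parts, the weighted sum `Σ_π χ_π` over all reverse plane partitions `π` of shape
`λ/μ` with entries in `{1,…,l}` (chains `μ = λ⁽⁰⁾ ⊆ ⋯ ⊆ λ⁽ˡ⁾ = λ`) and weight
`θ(π) = ν` equals `Σ_α L_{να} f_{αμ}^λ`, the sum over all partitions `α`.
(The latter sum is finite: terms vanish unless `α` has at most `k` parts, each `≤ |ν|`.) -/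
theorem stmt_3 (k l : ℕ) (lam mu : Fin k → ℕ) (hlam : Antitone lam)
    (hlampos : ∀ i, 0 < lam i) (hmu : Antitone mu) (hsub : ∀ i, mu i ≤ lam i)
    (nu : Fin l → ℕ) (hnu : Antitone nu) (hnupos : ∀ s, 0 < nu s) :
    ∑ π ∈ (Fintype.piFinset fun _ : Fin (l + 1) =>
          Fintype.piFinset fun _ : Fin k => Finset.range (Finset.univ.sup lam + 1)).filter
        (fun π =>
          π 0 = mu ∧ π (Fin.last l) = lam ∧
          (∀ s : Fin (l + 1), ∀ i j : Fin k, i ≤ j → π s j ≤ π s i) ∧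
          (∀ s : Fin l, ∀ i, π s.castSucc i ≤ π s.succ i) ∧
          (∀ s : Fin l, ∑ i, π s.succ i = ∑ i, π s.castSucc i + nu s)),
        ∏ s : Fin l, chiSkew (π s.succ) (π s.castSucc) =
      ∑ al ∈ (Fintype.piFinset fun _ : Fin k => Finset.range (∑ s, nu s + 1)).filter
          (fun al => ∀ i j : Fin k, i ≤ j → al j ≤ al i),
        LCard (pad nu) (pad al) * fCoeff al mu lam := by
  rw [rhs_eq, ← lhs_eq mu hmu (Finset.univ.sup lam) l nu lam hlam
    (fun i => Finset.le_sup (Finset.mem_univ i))]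
  apply Finset.sum_congr
  · ext π
    simp only [Finset.mem_filter]
    exact Iff.rfl
  · intro π _
    rfl
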